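/- (Regularized half-combination formula.) Let Xu be a real p×d matrix, Xv a real q×d matrix, Yu a real p×C matrix, and γ > 0. Set Cu := XuᵀXu, Cv := XvᵀXv, Cuʳ := Cu + γ·I, Cvʳ := Cv + γ·I, Ruʳ := (Cuʳ)⁻¹, 𝒲uʳ := I − Ruʳ·Cvʳ + Ruʳ·Cvʳ·(Cuʳ + Cvʳ)⁻¹·Cvʳ, and Ŵuʳ := Ruʳ·Xuᵀ·Yu. Then Cuʳ, Cvʳ, Cuʳ + Cvʳ, and Cu + Cv + 2γ·I are invertible, and 𝒲uʳ·Ŵuʳ = (Cu + Cv + 2γ·I)⁻¹·Xuᵀ·Yu. -/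

import Mathlib

open Matrix

namespace Matrix

theorem posDef_transpose_mul_self_add_smul_one {m n : Type*} [Fintype m] [Fintype n]
    [DecidableEq n] (X : Matrix m n ℝ) {γ : ℝ} (hγ : 0 < γ) :
    (Xᵀ * X + γ • (1 : Matrix n n ℝ)).PosDef := by
  have hX : (Xᵀ * X).PosSemidef := by
    simpa only [conjTranspose_eq_transpose_of_trivial] using posSemidef_conjTranspose_mul_self X
  exact PosDef.posSemidef_add hX (PosDef.one.smul hγ)

theorem one_sub_inv_mul_add_mul_inv_eq_inv_add {n R : Type*} [Fintype n] [DecidableEq n]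
    [CommRing R] {A B : Matrix n n R} (hA : IsUnit A) (hAB : IsUnit (A + B)) :
    (1 - A⁻¹ * B + A⁻¹ * B * (A + B)⁻¹ * B) * A⁻¹ = (A + B)⁻¹ := by
  have hA' : A⁻¹ * A = 1 := nonsing_inv_mul A ((isUnit_iff_isUnit_det A).mp hA)
  have hA'' : A * A⁻¹ = 1 := mul_nonsing_inv A ((isUnit_iff_isUnit_det A).mp hA)
  have hdet := (isUnit_iff_isUnit_det (A + B)).mp hAB
  have hS : (A + B)⁻¹ * (A + B) = 1 := nonsing_inv_mul _ hdet
  have hS' : (A + B) * (A + B)⁻¹ = 1 := mul_nonsing_inv _ hdet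
  have hleft : A⁻¹ * B * (A + B)⁻¹ = A⁻¹ - (A + B)⁻¹ := by
    calc A⁻¹ * B * (A + B)⁻¹
        = A⁻¹ * ((A + B) * (A + B)⁻¹) - A⁻¹ * A * (A + B)⁻¹ := by noncomm_ring
      _ = A⁻¹ - (A + B)⁻¹ := by rw [hS', hA', mul_one, one_mul]
  have hright : (A + B)⁻¹ * B = 1 - (A + B)⁻¹ * A := by
    rw [eq_sub_iff_add_eq', ← mul_add, hS]
  rw [hleft, sub_mul, hright]
  calc (1 - A⁻¹ * B + (A⁻¹ * B - (1 - (A + B)⁻¹ * A))) * A⁻¹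
      = (A + B)⁻¹ * (A * A⁻¹) := by noncomm_ring
    _ = (A + B)⁻¹ := by rw [hA'', mul_one]

end Matrix

/-- Regularized half-combination formula:
`𝒲uʳ·Ŵuʳ = (Cu + Cv + 2γI)⁻¹·Xuᵀ·Yu`, where `Cuʳ = Cu + γI`, `Cvʳ = Cv + γI`,
`Ruʳ = (Cuʳ)⁻¹`, `𝒲uʳ = I − Ruʳ·Cvʳ + Ruʳ·Cvʳ·(Cuʳ + Cvʳ)⁻¹·Cvʳ`, and
`Ŵuʳ = Ruʳ·Xuᵀ·Yu`. -/
theorem regularized_half_combination {p q d C : ℕ}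
    (Xu : Matrix (Fin p) (Fin d) ℝ) (Xv : Matrix (Fin q) (Fin d) ℝ)
    (Yu : Matrix (Fin p) (Fin C) ℝ)
    (γ : ℝ) (hγ : 0 < γ) :
    IsUnit (Xuᵀ * Xu + γ • (1 : Matrix (Fin d) (Fin d) ℝ)) ∧
    IsUnit (Xvᵀ * Xv + γ • (1 : Matrix (Fin d) (Fin d) ℝ)) ∧
    IsUnit ((Xuᵀ * Xu + γ • 1) + (Xvᵀ * Xv + γ • (1 : Matrix (Fin d) (Fin d) ℝ))) ∧
    IsUnit (Xuᵀ * Xu + Xvᵀ * Xv + (2 * γ) • (1 : Matrix (Fin d) (Fin d) ℝ)) ∧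
    (1 - (Xuᵀ * Xu + γ • 1)⁻¹ * (Xvᵀ * Xv + γ • 1)
       + (Xuᵀ * Xu + γ • 1)⁻¹ * (Xvᵀ * Xv + γ • 1) *
           ((Xuᵀ * Xu + γ • 1) + (Xvᵀ * Xv + γ • 1))⁻¹ * (Xvᵀ * Xv + γ • 1)) *
        ((Xuᵀ * Xu + γ • 1)⁻¹ * Xuᵀ * Yu)
      = (Xuᵀ * Xu + Xvᵀ * Xv + (2 * γ) • 1)⁻¹ * Xuᵀ * Yu := by
  have hu := posDef_transpose_mul_self_add_smul_one Xu hγ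
  have hv := posDef_transpose_mul_self_add_smul_one Xv hγ
  have hsum : Xuᵀ * Xu + Xvᵀ * Xv + (2 * γ) • (1 : Matrix (Fin d) (Fin d) ℝ) =
      (Xuᵀ * Xu + γ • 1) + (Xvᵀ * Xv + γ • 1) := by
    rw [two_mul, add_smul]
    abel
  rw [hsum]
  refine ⟨hu.isUnit, hv.isUnit, (hu.add hv).isUnit, (hu.add hv).isUnit, ?_⟩
  rw [← Matrix.mul_assoc, ← Matrix.mul_assoc,
    one_sub_inv_mul_add_mul_inv_eq_inv_add hu.isUnit (hu.add hv).isUnit]
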